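/- arXiv:2307.14836 — 3 statements merged into one kernel-verified Lean document; each statement's English description precedes it below -/
import Mathlib

section
/- Let h > 0, β > 0, let g(r) = (1/2)log(1 − r²) + (β²/2)(1 − r²)², q_P = max(1 − 1/(√2 β), 0), Plef(β) = [√q_P, 1], and 𝓑̃(α,r) = h (rα)² + β r² √(2(1 − α²)) + g(r). Define 𝓕(β) = β²/2 if β ≤ 1/√2 and 𝓕(β) = √2 β − 3/4 − (1/2)log(√2 β) if β ≥ 1/√2. If h > 1/2 and β < √2 h, then sup_{r ∈ Plef(β), α ∈ [-1,1]} 𝓑̃(α,r) = (β²/(8h²))(4h − 1) + h − (1/2)(1 + log(2h)), and the only maximizers are (α, r) = (±√(1 − β²/(2h²)), √(1 − 1/(2h))). If h ≤ 1/2 or β ≥ √2 h, then sup_{r ∈ Plef(β), α ∈ [-1,1]} 𝓑̃(α,r) = 𝓕(β), attained at (α,r) = (0, √q_P) (uniquely if β > 1/√2, and otherwise also at all points of {0} × [0,1]). -/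
theorem log_aux1 (x : ℝ) (h0 : 0 < x) (h1 : x < 1) :
    Real.log x < (x - 1) - (x - 1) ^ 2 / 2 := by
  have hd : ∀ y : ℝ, 0 < y → HasDerivAt (fun y : ℝ => (y - 1) - (y - 1) ^ 2 / 2 - Real.log y)
      (1 - (2 * (y - 1)) / 2 - y⁻¹) y := by
    intro y hy
    have e1 : HasDerivAt (fun y : ℝ => y - 1) 1 y := (hasDerivAt_id y).sub_const 1
    have e2 := ((e1.pow 2).div_const 2)
    have e3 := (e1.sub e2).sub (Real.hasDerivAt_log hy.ne')
    exact e3.congr_deriv (by norm_num)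
  have hm : StrictAntiOn (fun y : ℝ => (y - 1) - (y - 1) ^ 2 / 2 - Real.log y) (Set.Icc x 1) := by
    apply strictAntiOn_of_deriv_neg (convex_Icc x 1)
    · intro y hy
      exact (hd y (by linarith [hy.1])).continuousAt.continuousWithinAt
    · intro y hy
      rw [interior_Icc] at hy
      have hy0 : 0 < y := by linarith [hy.1]
      rw [(hd y hy0).deriv]
      have : 1 - (2 * (y - 1)) / 2 - y⁻¹ = - ((1 - y) ^ 2 / y) := by field_simp; ring
      rw [this]
      have : 0 < 1 - y := by linarith [hy.2]
      have : 0 < (1 - y) ^ 2 / y := by positivity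
      linarith
  have := hm (Set.left_mem_Icc.2 h1.le) (Set.right_mem_Icc.2 h1.le) h1
  simp at this
  linarith

theorem log_aux2 (x : ℝ) (h1 : 1 < x) :
    Real.log x < (x - 1) - (x - 1) ^ 2 / (2 * x) := by
  have hd : ∀ y : ℝ, 0 < y → HasDerivAt (fun y : ℝ => (y - y⁻¹) / 2 - Real.log y)
      ((1 - -(y ^ 2)⁻¹) / 2 - y⁻¹) y := by
    intro y hy
    exact (((hasDerivAt_id y).sub (hasDerivAt_inv hy.ne')).div_const 2).sub
      (Real.hasDerivAt_log hy.ne')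
  have hm : StrictMonoOn (fun y : ℝ => (y - y⁻¹) / 2 - Real.log y) (Set.Icc 1 x) := by
    apply strictMonoOn_of_deriv_pos (convex_Icc 1 x)
    · intro y hy
      exact (hd y (by linarith [hy.1])).continuousAt.continuousWithinAt
    · intro y hy
      rw [interior_Icc] at hy
      have hy0 : 0 < y := by linarith [hy.1]
      rw [(hd y hy0).deriv]
      have : (1 - -(y ^ 2)⁻¹) / 2 - y⁻¹ = (y - 1) ^ 2 / (2 * y ^ 2) := by field_simp; ring
      rw [this]
      have : 0 < y - 1 := by linarith [hy.1]
      positivity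
  have := hm (Set.left_mem_Icc.2 h1.le) (Set.right_mem_Icc.2 h1.le) h1
  simp at this
  have e : (x - 1) - (x - 1) ^ 2 / (2 * x) = (x - x⁻¹) / 2 := by
    have : x ≠ 0 := by linarith
    field_simp; ring
  linarith

theorem log_aux1' (x : ℝ) (h0 : 0 < x) (h1 : x ≤ 1) :
    Real.log x ≤ (x - 1) - (x - 1) ^ 2 / 2 := by
  rcases h1.lt_or_eq with h | h
  · exact (log_aux1 x h0 h).le
  · subst h; simp

/-- reduced functional -/
noncomputable def GG (h b s u : ℝ) : ℝ :=
  (1 - s) * (h * (1 - u ^ 2) + b * u) + 1 / 2 * Real.log s + b ^ 2 / 4 * s ^ 2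

theorem GG_case1 (h b s u : ℝ) (hh : 1 / 2 < h) (hb : 0 < b) (hbh : b < 2 * h)
    (hs : 0 < s) (hs1 : s ≤ 1) (hbs : b * s ≤ 1) :
    GG h b s u ≤ GG h b (1 / (2 * h)) (b / (2 * h)) ∧
    (GG h b s u = GG h b (1 / (2 * h)) (b / (2 * h)) → s = 1 / (2 * h) ∧ u = b / (2 * h)) := by
  have h0 : 0 < h := by linarith
  have key : GG h b s u - GG h b (1 / (2 * h)) (b / (2 * h)) =
      - ((1 - s) * (h * (u - b / (2 * h)) ^ 2)) +
      1 / 2 * (Real.log (2 * h * s) - (2 * h * s - 1)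
        + (b ^ 2 / (4 * h ^ 2)) * (2 * h * s - 1) ^ 2 / 2) := by
    unfold GG
    rw [Real.log_mul (by positivity) hs.ne', one_div (2 * h), Real.log_inv]
    field_simp
    ring
  have hρ : b ^ 2 / (4 * h ^ 2) < 1 := by
    rw [div_lt_one (by positivity)]; nlinarith
  have hlog : s ≠ 1 / (2 * h) → Real.log (2 * h * s) - (2 * h * s - 1)
        + (b ^ 2 / (4 * h ^ 2)) * (2 * h * s - 1) ^ 2 / 2 < 0 := by
    intro hne
    have hx : 0 < 2 * h * s := by positivity
    rcases lt_trichotomy (2 * h * s) 1 with hl | he | hg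
    · have := log_aux1 _ hx hl
      nlinarith [sq_nonneg (2 * h * s - 1)]
    · exact absurd (by field_simp; linarith) hne
    · have := log_aux2 _ hg
      have h2 : b ^ 2 / (4 * h ^ 2) ≤ 1 / (2 * h * s) := by
        rw [div_le_div_iff₀ (by positivity) (by positivity)]
        have : b * (b * s) ≤ 2 * h * 1 := by
          apply mul_le_mul hbh.le hbs (by positivity) (by positivity)
        nlinarith
      have h3 : (2 * h * s - 1) ^ 2 / (2 * (2 * h * s)) =
          1 / (2 * h * s) * (2 * h * s - 1) ^ 2 / 2 := by field_simp
      have h4 := mul_le_mul_of_nonneg_right h2 (sq_nonneg (2 * h * s - 1))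
      linarith
  have hA : 0 ≤ (1 - s) * (h * (u - b / (2 * h)) ^ 2) := by
    have : 0 ≤ 1 - s := by linarith
    positivity
  by_cases hse : s = 1 / (2 * h)
  · have h1 : 2 * h * s = 1 := by rw [hse]; field_simp
    have key : GG h b s u - GG h b (1 / (2 * h)) (b / (2 * h)) =
        - ((1 - s) * (h * (u - b / (2 * h)) ^ 2)) := by
      rw [key, h1, Real.log_one]; ring
    refine ⟨by linarith, fun he => ⟨hse, ?_⟩⟩
    have hs2 : 0 < 1 - s := by nlinarith
    have hz : (1 - s) * (h * (u - b / (2 * h)) ^ 2) = 0 := by linarith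
    have hz2 : (u - b / (2 * h)) ^ 2 = 0 := by
      rcases mul_eq_zero.1 hz with h | h
      · linarith
      · rcases mul_eq_zero.1 h with h | h
        · linarith
        · exact h
    have := pow_eq_zero_iff (two_ne_zero) |>.1 hz2
    linarith
  · have := hlog hse
    refine ⟨by linarith, fun he => ?_⟩
    exfalso; linarith

theorem GG_case2 (h b s u : ℝ) (hh : 0 < h) (hb : 1 < b) (hbh : 2 * h ≤ b)
    (hs : 0 < s) (hbs : b * s ≤ 1) (hu : u ≤ 1) :
    GG h b s u ≤ GG h b (1 / b) 1 ∧
    (GG h b s u = GG h b (1 / b) 1 → s = 1 / b ∧ u = 1) := by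
  have hb0 : 0 < b := by linarith
  have key : GG h b s u - GG h b (1 / b) 1 =
      - ((1 - s) * ((1 - u) * (b - h * (1 + u)))) +
      1 / 2 * (Real.log (b * s) - ((b * s - 1) - (b * s - 1) ^ 2 / 2)) := by
    unfold GG
    rw [Real.log_mul (by positivity) hs.ne', one_div b, Real.log_inv]
    field_simp
    ring
  have hs1 : 0 < 1 - s := by nlinarith
  have hA : 0 ≤ (1 - s) * ((1 - u) * (b - h * (1 + u))) := by
    apply mul_nonneg hs1.le
    apply mul_nonneg (by linarith)
    nlinarith
  have hl := log_aux1' (b * s) (by positivity) hbs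
  refine ⟨by linarith, fun he => ?_⟩
  constructor
  · rcases hbs.lt_or_eq with h1 | h1
    · have := log_aux1 (b * s) (by positivity) h1
      exfalso; linarith
    · field_simp; linarith
  · by_contra hne
    have hu' : u < 1 := lt_of_le_of_ne hu hne
    have : 0 < (1 - s) * ((1 - u) * (b - h * (1 + u))) := by
      apply mul_pos hs1
      apply mul_pos (by linarith)
      nlinarith
    linarith

theorem GG_case3 (h b s u : ℝ) (hh : 0 < h) (hb0 : 0 < b) (hb : b ≤ 1)
    (hbh : h ≤ 1 / 2 ∨ 2 * h ≤ b)
    (hs : 0 < s) (hs1 : s ≤ 1) (hu : u ^ 2 ≤ 1) :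
    GG h b s u ≤ b ^ 2 / 4 := by
  have hh' : h ≤ 1 / 2 := by
    rcases hbh with h | h <;> linarith
  have hl := log_aux1' s hs hs1
  have h1 : h * (1 - u ^ 2) + b * u - b ^ 2 / 4 * (1 + s) ≤ (3 - s) / 4 := by
    have : h * (1 - u ^ 2) ≤ 1 / 2 * (1 - u ^ 2) :=
      mul_le_mul_of_nonneg_right hh' (by linarith)
    have hb2 : b ^ 2 ≤ 1 := by nlinarith
    have := mul_le_mul_of_nonneg_right hb2 (sub_nonneg.2 hs1)
    nlinarith [sq_nonneg (b - u)]
  have h2 := mul_le_mul_of_nonneg_left h1 (sub_nonneg.2 hs1)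
  unfold GG
  nlinarith

set_option maxHeartbeats 1000000 in
/-- Lemma: TAP maximizer with quadratic spike `f(x) = hx²`.
Since `g` is only defined for `r ∈ [0,1)` (it involves `log(1−r²)`), suprema and maximizers
over the Plefka region `Plef(β) = [√q_P, 1]` are taken over `[√q_P, 1)`. -/
theorem stmt_15 (h β : ℝ) (hh : 0 < h) (hβ : 0 < β)
    (g : ℝ → ℝ)
    (hg : ∀ r, g r = (1 / 2) * Real.log (1 - r ^ 2) + (β ^ 2 / 2) * (1 - r ^ 2) ^ 2)
    (qP : ℝ) (hqP : qP = max (1 - 1 / (Real.sqrt 2 * β)) 0)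
    (Bt : ℝ → ℝ → ℝ)
    (hBt : ∀ α r, Bt α r = h * (r * α) ^ 2 + β * r ^ 2 * Real.sqrt (2 * (1 - α ^ 2)) + g r)
    (F : ℝ)
    (hF : F = if β ≤ 1 / Real.sqrt 2 then β ^ 2 / 2
      else Real.sqrt 2 * β - 3 / 4 - (1 / 2) * Real.log (Real.sqrt 2 * β)) :
    (h > 1 / 2 ∧ β < Real.sqrt 2 * h →
      sSup {y : ℝ | ∃ r ∈ Set.Ico (Real.sqrt qP) 1, ∃ α ∈ Set.Icc (-1 : ℝ) 1, y = Bt α r} =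
        (β ^ 2 / (8 * h ^ 2)) * (4 * h - 1) + h - (1 / 2) * (1 + Real.log (2 * h)) ∧
      IsMaxOn (fun p : ℝ × ℝ => Bt p.1 p.2)
        (Set.Icc (-1 : ℝ) 1 ×ˢ Set.Ico (Real.sqrt qP) 1)
        (Real.sqrt (1 - β ^ 2 / (2 * h ^ 2)), Real.sqrt (1 - 1 / (2 * h))) ∧
      IsMaxOn (fun p : ℝ × ℝ => Bt p.1 p.2)
        (Set.Icc (-1 : ℝ) 1 ×ˢ Set.Ico (Real.sqrt qP) 1)
        (-Real.sqrt (1 - β ^ 2 / (2 * h ^ 2)), Real.sqrt (1 - 1 / (2 * h))) ∧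
      ∀ p ∈ Set.Icc (-1 : ℝ) 1 ×ˢ Set.Ico (Real.sqrt qP) 1,
        IsMaxOn (fun p : ℝ × ℝ => Bt p.1 p.2)
            (Set.Icc (-1 : ℝ) 1 ×ˢ Set.Ico (Real.sqrt qP) 1) p →
          p = (Real.sqrt (1 - β ^ 2 / (2 * h ^ 2)), Real.sqrt (1 - 1 / (2 * h))) ∨
          p = (-Real.sqrt (1 - β ^ 2 / (2 * h ^ 2)), Real.sqrt (1 - 1 / (2 * h)))) ∧
    (h ≤ 1 / 2 ∨ Real.sqrt 2 * h ≤ β →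
      sSup {y : ℝ | ∃ r ∈ Set.Ico (Real.sqrt qP) 1, ∃ α ∈ Set.Icc (-1 : ℝ) 1, y = Bt α r} = F ∧
      IsMaxOn (fun p : ℝ × ℝ => Bt p.1 p.2)
        (Set.Icc (-1 : ℝ) 1 ×ˢ Set.Ico (Real.sqrt qP) 1) (0, Real.sqrt qP) ∧
      (1 / Real.sqrt 2 < β →
        ∀ p ∈ Set.Icc (-1 : ℝ) 1 ×ˢ Set.Ico (Real.sqrt qP) 1,
          IsMaxOn (fun p : ℝ × ℝ => Bt p.1 p.2)
              (Set.Icc (-1 : ℝ) 1 ×ˢ Set.Ico (Real.sqrt qP) 1) p →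
            p = (0, Real.sqrt qP)) ∧
      (β ≤ 1 / Real.sqrt 2 →
        ∀ α ∈ Set.Icc (0 : ℝ) 1,
          IsMaxOn (fun p : ℝ × ℝ => Bt p.1 p.2)
            (Set.Icc (-1 : ℝ) 1 ×ˢ Set.Ico (Real.sqrt qP) 1) (α, 0))) := by
  have s2 : (0:ℝ) < Real.sqrt 2 := by positivity
  have s22 : Real.sqrt 2 ^ 2 = 2 := Real.sq_sqrt (by norm_num)
  obtain ⟨b, hb⟩ : ∃ b, b = Real.sqrt 2 * β := ⟨_, rfl⟩
  have hb0 : 0 < b := by rw [hb]; positivity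
  have hb2 : b ^ 2 = 2 * β ^ 2 := by rw [hb, mul_pow, s22]
  have hble : β ≤ 1 / Real.sqrt 2 ↔ b ≤ 1 := by
    rw [le_div_iff₀ s2, hb, mul_comm]
  have hbh : Real.sqrt 2 * h ≤ β ↔ 2 * h ≤ b := by
    rw [hb]
    have e : 2 * h = Real.sqrt 2 * (Real.sqrt 2 * h) := by
      rw [← mul_assoc, ← sq, s22]
    rw [e]
    exact (mul_le_mul_iff_right₀ s2).symm
  rw [← hb] at hqP hF
  have hq0 : 0 ≤ qP := by rw [hqP]; exact le_max_right _ _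
  have hq1 : qP < 1 := by
    rw [hqP]; apply max_lt _ one_pos
    have : 0 < 1 / b := by positivity
    linarith
  have hqb : 1 - 1 / b ≤ qP := by rw [hqP]; exact le_max_left _ _
  have hsq0 := Real.sqrt_nonneg qP
  have hB : ∀ α r, Bt α r = GG h b (1 - r ^ 2) (Real.sqrt (1 - α ^ 2)) ∨ α ∉ Set.Icc (-1:ℝ) 1 := by
    intro α r
    by_cases hα : α ∈ Set.Icc (-1:ℝ) 1
    · left
      have h1 : 0 ≤ 1 - α ^ 2 := by nlinarith [hα.1, hα.2]
      rw [hBt, hg, GG, Real.sqrt_mul (by norm_num), Real.sq_sqrt h1, hb2, hb]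
      ring
    · right; exact hα
  have hB : ∀ α ∈ Set.Icc (-1:ℝ) 1, ∀ r,
      Bt α r = GG h b (1 - r ^ 2) (Real.sqrt (1 - α ^ 2)) := by
    intro α hα r
    rcases hB α r with h | h
    · exact h
    · exact absurd hα h
  have hr : ∀ r ∈ Set.Ico (Real.sqrt qP) 1, 0 < 1 - r ^ 2 ∧ 1 - r ^ 2 ≤ 1 ∧ b * (1 - r ^ 2) ≤ 1
      ∧ 0 ≤ r := by
    intro r hr
    have hr0 : 0 ≤ r := hsq0.trans hr.1
    have h1 : qP ≤ r ^ 2 := by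
      rw [← Real.sq_sqrt hq0]
      exact pow_le_pow_left₀ hsq0 hr.1 2
    refine ⟨by nlinarith [hr.2], by nlinarith, ?_, hr0⟩
    have : 1 - r ^ 2 ≤ 1 / b := by linarith
    calc b * (1 - r ^ 2) ≤ b * (1 / b) := mul_le_mul_of_nonneg_left this hb0.le
      _ = 1 := by field_simp
  have hpos : ∀ α ∈ Set.Icc (-1:ℝ) 1, 0 ≤ 1 - α ^ 2 := by
    intro α hα
    have := mul_nonneg (sub_nonneg.2 hα.1) (sub_nonneg.2 hα.2)
    nlinarith only [this]
  have hu : ∀ α ∈ Set.Icc (-1:ℝ) 1, Real.sqrt (1 - α ^ 2) ≤ 1 ∧ Real.sqrt (1 - α ^ 2) ^ 2 ≤ 1 := by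
    intro α hα
    have h1 : 0 ≤ 1 - α ^ 2 := by nlinarith [hα.1, hα.2]
    refine ⟨?_, ?_⟩
    · exact Real.sqrt_le_iff.2 ⟨by norm_num, by linarith [sq_nonneg α]⟩
    · rw [Real.sq_sqrt h1]; nlinarith
  have gen : ∀ V α₀ r₀, α₀ ∈ Set.Icc (-1:ℝ) 1 → r₀ ∈ Set.Ico (Real.sqrt qP) 1 →
      Bt α₀ r₀ = V → (∀ α ∈ Set.Icc (-1:ℝ) 1, ∀ r ∈ Set.Ico (Real.sqrt qP) 1, Bt α r ≤ V) →
      sSup {y : ℝ | ∃ r ∈ Set.Ico (Real.sqrt qP) 1, ∃ α ∈ Set.Icc (-1 : ℝ) 1, y = Bt α r} = V := by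
    intro V α₀ r₀ hα hr₀ hV hle
    apply IsGreatest.csSup_eq
    refine ⟨⟨r₀, hr₀, α₀, hα, hV.symm⟩, ?_⟩
    rintro y ⟨r, hr, α, hα, rfl⟩
    exact hle α hα r hr
  have gmax : ∀ V α₀ r₀, 
      Bt α₀ r₀ = V → (∀ α ∈ Set.Icc (-1:ℝ) 1, ∀ r ∈ Set.Ico (Real.sqrt qP) 1, Bt α r ≤ V) →
      IsMaxOn (fun p : ℝ × ℝ => Bt p.1 p.2)
        (Set.Icc (-1 : ℝ) 1 ×ˢ Set.Ico (Real.sqrt qP) 1) (α₀, r₀) := by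
    intro V α₀ r₀ hV hle p hp
    show Bt p.1 p.2 ≤ Bt α₀ r₀
    rw [hV]
    exact hle _ hp.1 _ hp.2
  constructor
  · rintro ⟨hh1, hh2⟩
    have hbl : b < 2 * h := by
      rw [← not_le, ← hbh, not_le]; exact hh2
    have hρ0 : 0 < 1 - β ^ 2 / (2 * h ^ 2) := by
      rw [sub_pos, div_lt_one (by positivity)]; nlinarith
    have hρ1 : 1 - β ^ 2 / (2 * h ^ 2) ≤ 1 := by
      have : 0 ≤ β ^ 2 / (2 * h ^ 2) := by positivity
      linarith
    have ht0 : 0 < 1 / (2 * h) := by positivity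
    have ht1 : 1 / (2 * h) < 1 := by
      rw [div_lt_one (by positivity)]; linarith
    have htq : qP ≤ 1 - 1 / (2 * h) := by
      rw [hqP]
      apply max_le _ (by linarith)
      have : 1 / (2 * h) ≤ 1 / b := one_div_le_one_div_of_le hb0 hbl.le
      linarith
    obtain ⟨A, hA⟩ : ∃ A, A = Real.sqrt (1 - β ^ 2 / (2 * h ^ 2)) := ⟨_, rfl⟩
    obtain ⟨R, hR⟩ : ∃ R, R = Real.sqrt (1 - 1 / (2 * h)) := ⟨_, rfl⟩
    have hA0 : 0 ≤ A := by rw [hA]; exact Real.sqrt_nonneg _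
    have hA2 : A ^ 2 = 1 - β ^ 2 / (2 * h ^ 2) := by rw [hA, Real.sq_sqrt hρ0.le]
    have hR0 : 0 ≤ R := by rw [hR]; exact Real.sqrt_nonneg _
    have hR2 : R ^ 2 = 1 - 1 / (2 * h) := by rw [hR, Real.sq_sqrt (by linarith)]
    rw [← hA, ← hR]
    have hA1 : A ≤ 1 := by
      rw [← sq_le_one_iff₀ hA0, hA2]; exact hρ1
    have hAm : A ∈ Set.Icc (-1:ℝ) 1 := ⟨by linarith, hA1⟩
    have hAm' : -A ∈ Set.Icc (-1:ℝ) 1 := ⟨by linarith, by linarith⟩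
    have hRm : R ∈ Set.Ico (Real.sqrt qP) 1 := by
      refine ⟨?_, by rw [← sq_lt_one_iff₀ hR0, hR2]; linarith⟩
      rw [hR]; exact Real.sqrt_le_sqrt htq
    have hsA : Real.sqrt (1 - A ^ 2) = b / (2 * h) := by
      rw [Real.sqrt_eq_iff_mul_self_eq (by rw [hA2]; ring_nf; positivity) (by positivity), hA2]
      have : b / (2 * h) * (b / (2 * h)) = b ^ 2 / (4 * h ^ 2) := by field_simp; norm_num
      rw [this, hb2]; field_simp; ring
    have hV : GG h b (1 / (2 * h)) (b / (2 * h)) =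
        (β ^ 2 / (8 * h ^ 2)) * (4 * h - 1) + h - (1 / 2) * (1 + Real.log (2 * h)) := by
      have hβ2 : β ^ 2 = b ^ 2 / 2 := by linarith
      rw [GG, one_div (2 * h), Real.log_inv, hβ2]
      field_simp
      ring
    have e1 : Bt A R = GG h b (1 / (2 * h)) (b / (2 * h)) := by
      rw [hB A hAm, hsA, hR2]; ring_nf
    have e2 : Bt (-A) R = GG h b (1 / (2 * h)) (b / (2 * h)) := by
      rw [hB (-A) hAm', neg_sq, hsA, hR2]; ring_nf
    have hle : ∀ α ∈ Set.Icc (-1:ℝ) 1, ∀ r ∈ Set.Ico (Real.sqrt qP) 1,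
        Bt α r ≤ GG h b (1 / (2 * h)) (b / (2 * h)) := by
      intro α hα r hr'
      obtain ⟨a1, a2, a3, a4⟩ := hr r hr'
      rw [hB α hα]
      exact (GG_case1 h b _ _ hh1 hb0 hbl a1 a2 a3).1
    refine ⟨?_, gmax _ _ _ e1 hle, gmax _ _ _ e2 hle, ?_⟩
    · rw [← hV]; exact gen _ _ _ hAm hRm e1 hle
    · rintro ⟨α, r⟩ ⟨hα, hr'⟩ hm
      simp only at hα hr'
      have h1 : Bt A R ≤ Bt α r := hm (show (A, R) ∈ _ from ⟨hAm, hRm⟩)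
      have h2 := le_antisymm (hle α hα r hr') (e1 ▸ h1)
      rw [hB α hα] at h2
      obtain ⟨a1, a2, a3, a4⟩ := hr r hr'
      obtain ⟨c1, c2⟩ := (GG_case1 h b _ _ hh1 hb0 hbl a1 a2 a3).2 h2
      have hrR : r = R := by
        rw [← sq_eq_sq₀ a4 hR0, hR2]; linarith
      have hαA : α ^ 2 = A ^ 2 := by
        rw [← hsA] at c2
        have p1 : 0 ≤ 1 - α ^ 2 := hpos α hα
        have p2 : 0 ≤ 1 - A ^ 2 := by linarith
        have := (Real.sqrt_inj p1 p2).1 c2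
        linarith
      rcases sq_eq_sq_iff_eq_or_eq_neg.1 hαA with h | h
      · left; rw [h, hrR]
      · right; rw [h, hrR]
  · intro hc
    rw [hbh] at hc
    have z0 : (0:ℝ) ∈ Set.Icc (-1:ℝ) 1 := by constructor <;> norm_num
    have hqm : Real.sqrt qP ∈ Set.Ico (Real.sqrt qP) 1 := by
      refine ⟨le_rfl, ?_⟩
      rw [Real.sqrt_lt' one_pos]; linarith
    have hBz : Bt 0 (Real.sqrt qP) = GG h b (1 - qP) 1 := by
      rw [hB 0 z0, Real.sq_sqrt hq0]; norm_num
    by_cases hb1 : b ≤ 1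
    · rw [if_pos (hble.2 hb1)] at hF
      have hFb : F = b ^ 2 / 4 := by rw [hF, hb2]; ring
      have hq : qP = 0 := by
        rw [hqP]; apply max_eq_right
        have : 1 ≤ 1 / b := by rw [le_div_iff₀ hb0]; linarith
        linarith
      have e0 : ∀ α, Bt α 0 = F := by
        intro α; rw [hBt, hg, hF]; norm_num
      have hle : ∀ α ∈ Set.Icc (-1:ℝ) 1, ∀ r ∈ Set.Ico (Real.sqrt qP) 1, Bt α r ≤ F := by
        intro α hα r hr'
        obtain ⟨a1, a2, a3, a4⟩ := hr r hr'
        rw [hB α hα, hFb]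
        exact GG_case3 h b _ _ hh hb0 hb1 hc a1 a2 (hu α hα).2
      have e1 : Bt 0 (Real.sqrt qP) = F := by rw [hq, Real.sqrt_zero]; exact e0 0
      refine ⟨gen _ _ _ z0 hqm e1 hle, gmax _ _ _ e1 hle, ?_, ?_⟩
      · intro hlt
        exact absurd (hble.2 hb1) (not_le.2 hlt)
      · intro _ α _
        exact gmax _ _ _ (e0 α) hle
    · have hb1' : 1 < b := not_le.1 hb1
      rw [if_neg (fun h => hb1 (hble.1 h))] at hF
      have hbl : 2 * h ≤ b := by
        rcases hc with h | h <;> linarith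
      have hq : 1 - qP = 1 / b := by
        have : qP = 1 - 1 / b := by
          rw [hqP]; apply max_eq_left
          have : 1 / b ≤ 1 := by rw [div_le_iff₀ hb0]; linarith
          linarith
        rw [this]; ring
      have hV : GG h b (1 / b) 1 = F := by
        rw [GG, hF, one_div b, Real.log_inv]
        field_simp
        ring
      have e1 : Bt 0 (Real.sqrt qP) = F := by rw [hBz, hq, hV]
      have hle : ∀ α ∈ Set.Icc (-1:ℝ) 1, ∀ r ∈ Set.Ico (Real.sqrt qP) 1, Bt α r ≤ F := by
        intro α hα r hr'
        obtain ⟨a1, a2, a3, a4⟩ := hr r hr'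
        rw [hB α hα, ← hV]
        exact (GG_case2 h b _ _ hh hb1' hbl a1 a3 (hu α hα).1).1
      refine ⟨gen _ _ _ z0 hqm e1 hle, gmax _ _ _ e1 hle, ?_, ?_⟩
      · rintro - ⟨α, r⟩ ⟨hα, hr'⟩ hm
        simp only at hα hr'
        have h1 : Bt 0 (Real.sqrt qP) ≤ Bt α r :=
          hm (show ((0:ℝ), Real.sqrt qP) ∈ _ from ⟨z0, hqm⟩)
        have h2 := le_antisymm (hle α hα r hr') (e1 ▸ h1)
        rw [hB α hα, ← hV] at h2
        obtain ⟨a1, a2, a3, a4⟩ := hr r hr'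
        obtain ⟨c1, c2⟩ := (GG_case2 h b _ _ hh hb1' hbl a1 a3 (hu α hα).1).2 h2
        have hrR : r = Real.sqrt qP := by
          rw [← sq_eq_sq₀ a4 hsq0, Real.sq_sqrt hq0]; linarith
        have hα0 : α = 0 := by
          rw [Real.sqrt_eq_one] at c2
          have : α ^ 2 = 0 := by linarith
          exact pow_eq_zero_iff two_ne_zero |>.1 this
        rw [hα0, hrR]
      · intro h
        exact absurd (hble.1 h) hb1
end

section
/- Let k ≥ 1 be an integer, h > 0, β > 0, and define 𝓑(α) = h α^k + β√(2(1 − α²)) for α ∈ [-1,1]. Let β_c(k,h) = ∞ if k = 1, β_c(2,h) = √2 h, and β_c(k,h) = (h/√2) · ((k−1)/(k−2)) · (1 − 1/(k−1)²)^{k/2} for k ≥ 3. If β < β_c(k,h), then every global maximizer α̂ ∈ (-1,1) of 𝓑 satisfies 𝓑''(α̂) < 0. -/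
theorem aux_sqrt (x : ℝ) (hx : x ∈ Set.Ioo (-1 : ℝ) 1) :
    0 < Real.sqrt (2 * (1 - x ^ 2)) ∧ Real.sqrt (2 * (1 - x ^ 2)) ^ 2 = 2 * (1 - x ^ 2) ∧
    HasDerivAt (fun y : ℝ => Real.sqrt (2 * (1 - y ^ 2)))
      (-(2 * x) / Real.sqrt (2 * (1 - x ^ 2))) x := by
  have hp : 0 < 2 * (1 - x ^ 2) := by nlinarith [hx.1, hx.2]
  have hs := Real.sqrt_pos.2 hp
  refine ⟨hs, Real.sq_sqrt hp.le, ?_⟩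
  have h1 : HasDerivAt (fun y : ℝ => 2 * (1 - y ^ 2)) (2 * (-(2 * x))) x := by
    have := (((hasDerivAt_id x).pow 2).const_sub 1).const_mul 2
    refine this.congr_deriv ?_
    norm_num
  convert h1.sqrt hp.ne' using 1
  field_simp

theorem aux_d1 (k : ℕ) (h β x : ℝ) (hx : x ∈ Set.Ioo (-1 : ℝ) 1) :
    HasDerivAt (fun α : ℝ => h * α ^ k + β * Real.sqrt (2 * (1 - α ^ 2)))
      (h * (k * x ^ (k - 1)) + β * (-(2 * x) / Real.sqrt (2 * (1 - x ^ 2)))) x :=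
  ((hasDerivAt_pow k x).const_mul h).add ((aux_sqrt x hx).2.2.const_mul β)

theorem aux_d2 (k : ℕ) (h β x : ℝ) (hx : x ∈ Set.Ioo (-1 : ℝ) 1) :
    deriv (deriv (fun α : ℝ => h * α ^ k + β * Real.sqrt (2 * (1 - α ^ 2)))) x
      = h * (k * ((k - 1 : ℕ) * x ^ (k - 1 - 1))) - 4 * β / Real.sqrt (2 * (1 - x ^ 2)) ^ 3 := by
  obtain ⟨hs, hs2, hd⟩ := aux_sqrt x hx
  have he : deriv (fun α : ℝ => h * α ^ k + β * Real.sqrt (2 * (1 - α ^ 2))) =ᶠ[nhds x]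
      fun x => h * (k * x ^ (k - 1)) + β * (-(2 * x) / Real.sqrt (2 * (1 - x ^ 2))) := by
    filter_upwards [Ioo_mem_nhds hx.1 hx.2] with y hy
    exact (aux_d1 k h β y hy).deriv
  rw [he.deriv_eq]
  have h2 : HasDerivAt (fun y : ℝ => -(2 * y)) (-(2 * 1)) x :=
    ((hasDerivAt_id x).const_mul 2).neg
  have h3 := (((hasDerivAt_pow (k - 1) x).const_mul (k : ℝ)).const_mul h).add
    ((h2.div hd hs.ne').const_mul β)
  refine h3.deriv.trans ?_
  generalize Real.sqrt (2 * (1 - x ^ 2)) = s at *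
  have : (-(2 * 1) * s - -(2 * x) * (-(2 * x) / s)) / s ^ 2 = -4 / s ^ 3 := by
    have hx2 : x ^ 2 = 1 - s ^ 2 / 2 := by linarith
    field_simp
    rw [hx2]
    ring
  rw [this]
  ring

/-- Lemma: second derivative at global maximizers of
`𝓑(α) = hα^k + β√(2(1−α²))` is negative below the critical temperature.
The hypothesis `hβlt` says `β < β_c(k,h)`, where `β_c(1,h) = ∞`, `β_c(2,h) = √2·h`, and
`β_c(k,h) = (h/√2)·((k−1)/(k−2))·(1 − 1/(k−1)²)^{k/2}` for `k ≥ 3` (the power `x^{k/2}`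
of the nonnegative quantity `x = 1 − 1/(k−1)²` is written `(√x)^k`). -/
theorem stmt_17 (k : ℕ) (hk : 1 ≤ k) (h β : ℝ) (hh : 0 < h) (hβ : 0 < β)
    (B : ℝ → ℝ) (hB : ∀ α, B α = h * α ^ k + β * Real.sqrt (2 * (1 - α ^ 2)))
    (hβlt : k = 1 ∨ (k = 2 ∧ β < Real.sqrt 2 * h) ∨
      (3 ≤ k ∧ β < h / Real.sqrt 2 * (((k : ℝ) - 1) / ((k : ℝ) - 2)) *
        Real.sqrt (1 - 1 / ((k : ℝ) - 1) ^ 2) ^ k)) :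
    ∀ αh ∈ Set.Ioo (-1 : ℝ) 1, IsMaxOn B (Set.Icc (-1) 1) αh →
      deriv (deriv B) αh < 0 := by
  intro a ha hmax
  have hBf : B = fun α : ℝ => h * α ^ k + β * Real.sqrt (2 * (1 - α ^ 2)) := funext hB
  have hcrit : h * (k * a ^ (k - 1)) + β * (-(2 * a) / Real.sqrt (2 * (1 - a ^ 2))) = 0 := by
    have hl : IsLocalMax B a := hmax.isLocalMax (Icc_mem_nhds ha.1 ha.2)
    have hd := aux_d1 k h β a ha
    rw [← hBf] at hd
    exact hl.hasDerivAt_eq_zero hd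
  have hm0 : B 0 ≤ B a := hmax (by constructor <;> norm_num)
  obtain ⟨hs, hs2, -⟩ := aux_sqrt a ha
  have hd2 := aux_d2 k h β a ha
  rw [← hBf] at hd2
  rw [hd2]
  have hr0 : 0 < Real.sqrt 2 := by positivity
  have hr2 : Real.sqrt 2 ^ 2 = 2 := Real.sq_sqrt (by norm_num)
  obtain ⟨n, rfl | rfl⟩ : ∃ n, k = 1 ∨ k = n + 2 := ⟨k - 2, by omega⟩
  · simp only [Nat.sub_self, Nat.cast_zero, zero_mul, mul_zero, zero_sub]
    have : 0 < 4 * β / Real.sqrt (2 * (1 - a ^ 2)) ^ 3 := by positivity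
    linarith
  have e1 : n + 2 - 1 = n + 1 := rfl
  rw [e1] at hcrit ⊢
  rw [Nat.add_sub_cancel]
  push_cast at hcrit ⊢
  by_cases ha0 : a = 0
  · subst ha0
    rcases Nat.eq_zero_or_pos n with hn | hn
    · subst hn
      exfalso
      have hlt : β < Real.sqrt 2 * h := by
        rcases hβlt with h1 | h1 | h1
        · omega
        · exact h1.2
        · omega
      obtain ⟨w, hw⟩ : ∃ w, w = β / (Real.sqrt 2 * h) := ⟨_, rfl⟩
      have hw0 : 0 < w := by rw [hw]; positivity
      have hw1 : w < 1 := by rw [hw, div_lt_one (by positivity)]; exact hlt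
      have hbw : β = Real.sqrt 2 * h * w := by rw [hw]; field_simp
      have hw2 : 0 ≤ 1 - w ^ 2 := by nlinarith
      have hq := Real.sq_sqrt hw2
      have hq0 := Real.sqrt_nonneg (1 - w ^ 2)
      have hm : B (Real.sqrt (1 - w ^ 2)) ≤ B 0 := by
        apply hmax
        constructor
        · linarith
        · nlinarith
      rw [hB, hB] at hm
      norm_num [hq] at hm
      rw [Real.sqrt_sq hw0.le] at hm
      have h5 : β * Real.sqrt 2 = 2 * h * w := by
        rw [hbw]; linear_combination h * w * hr2
      have h6 : 0 < h * (1 - w) ^ 2 := by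
        have : 0 < 1 - w := by linarith
        positivity
      nlinarith
    · rw [zero_pow hn.ne']
      have : 0 < 4 * β / Real.sqrt (2 * (1 - (0 : ℝ) ^ 2)) ^ 3 := by positivity
      linarith
  rw [hB, hB, zero_pow (by omega), zero_pow (by omega), sub_zero, mul_one, mul_zero,
    zero_add] at hm0
  have hslt : Real.sqrt (2 * (1 - a ^ 2)) < Real.sqrt 2 := by
    apply Real.sqrt_lt_sqrt
    · nlinarith [ha.1, ha.2]
    · have : 0 < a ^ 2 := by positivity
      linarith
  generalize Real.sqrt (2 * (1 - a ^ 2)) = s at *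
  generalize Real.sqrt 2 = r at *
  have hP : h * (n + 2) * a ^ n * s = 2 * β := by
    apply mul_right_cancel₀ ha0
    field_simp at hcrit
    rw [pow_succ] at hcrit
    linear_combination hcrit
  have hn0 : (0 : ℝ) ≤ n := Nat.cast_nonneg n
  have hk1 : 0 ≤ (r - s) * (r - (n + 1) * s) := by
    have h7 : 0 ≤ (n + 2) * s * (h * a ^ (n + 2) + β * s - β * r) := by
      apply mul_nonneg (by positivity)
      linarith
    have h8 : (n + 2) * s * (h * a ^ (n + 2) + β * s - β * r)
        = β * ((r - s) * (r - (n + 1) * s)) := by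
      rw [pow_add]
      linear_combination a ^ 2 * hP - β * hr2 + β * hs2
    rw [h8] at h7
    exact nonneg_of_mul_nonneg_right h7 hβ
  have hk2 : 0 ≤ r - (n + 1) * s := nonneg_of_mul_nonneg_right hk1 (by linarith)
  have hk3 : (n + 1) * s ^ 2 < 2 := by nlinarith
  have hfin : h * ((n + 2) * ((n + 1) * a ^ n)) - 4 * β / s ^ 3
      = 2 * β * ((n + 1) * s ^ 2 - 2) / s ^ 3 := by
    field_simp
    linear_combination (n + 1) * s ^ 2 * hP
  have hgoal : 2 * β * ((n + 1) * s ^ 2 - 2) / s ^ 3 < 0 :=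
    div_neg_of_neg_of_pos (mul_neg_of_pos_of_neg (by linarith) (by linarith)) (by positivity)
  first
    | (rw [hfin]; exact hgoal)
    | (have := hfin ▸ hgoal; simpa using this)
end

section
/- Let n ≥ 1, d > 0, η > 0, let A(d) = { a ∈ ℝⁿ : |a| ≤ d }, and let t : A(d) × [-η, η] → ℝ be twice continuously differentiable. Assume: (i) ∂_{bb} t(a,b) > 0 for all a ∈ A(d), b ∈ [-η, η]; (ii) ∂_b t(a, η) > 0 and ∂_b t(a, -η) < 0 for all a ∈ A(d); (iii) the largest eigenvalue of the matrix ∇²_a t(a,b) − (1/∂_{bb} t(a,b)) (∂_b ∇_a t)(a,b) (∂_b ∇_a t)(a,b)ᵀ is negative for all a ∈ A(d), b ∈ [-η, η]; and (iv) for every a with |a| = d, the directional derivative of a ↦ inf_{b ∈ [-η,η]} t(a,b) in the direction a exists and is negative. Then t has a unique critical point in A(d) × [-η, η], and sup_{a ∈ A(d)} inf_{b ∈ [-η, η]} t(a,b) is achieved uniquely at this critical point. -/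
open Filter Topology Set

section aux
variable {E : Type*} [NormedAddCommGroup E] [NormedSpace ℝ E]

lemma aux_min_endpoint {f : ℝ → ℝ} {x y c : ℝ} {S : Set ℝ} (hS : segment ℝ x y ⊆ S)
    (hm : IsMinOn f S x) (hf : HasDerivWithinAt f c S x) : 0 ≤ (y - x) * c := by
  have h1 : IsLocalMinOn f S x := hm.localize
  have h2 := h1.hasFDerivWithinAt_nonneg hf.hasFDerivWithinAt
    (sub_mem_posTangentConeAt_of_segment_subset hS)
  simpa using h2

lemma aux_T1 {t : E → ℝ → ℝ} (ht : ContDiff ℝ 2 fun p : E × ℝ => t p.1 p.2) (p : E × ℝ) :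
    HasFDerivAt (fun p : E × ℝ => t p.1 p.2) (fderiv ℝ (fun p : E × ℝ => t p.1 p.2) p) p :=
  (ht.differentiable (by norm_num) p).hasFDerivAt

lemma aux_T2 {t : E → ℝ → ℝ} (ht : ContDiff ℝ 2 fun p : E × ℝ => t p.1 p.2) (p : E × ℝ) :
    HasFDerivAt (fderiv ℝ (fun p : E × ℝ => t p.1 p.2))
      (fderiv ℝ (fderiv ℝ (fun p : E × ℝ => t p.1 p.2)) p) p :=
  ((ht.fderiv_right (m := 1) (by norm_num)).differentiable (by norm_num) p).hasFDerivAt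

lemma aux_line (a v : E) (b k s : ℝ) :
    HasDerivAt (fun s : ℝ => (a + s • v, b + s * k)) (v, k) s := by
  refine HasDerivAt.prodMk ?_ ?_
  · simpa using ((hasDerivAt_id s).smul_const v).const_add a
  · simpa using ((hasDerivAt_id s).mul_const k).const_add b

lemma aux_g1 {t : E → ℝ → ℝ} (ht : ContDiff ℝ 2 fun p : E × ℝ => t p.1 p.2)
    (a v : E) (b k s : ℝ) :
    HasDerivAt (fun s : ℝ => t (a + s • v) (b + s * k))
      (fderiv ℝ (fun p : E × ℝ => t p.1 p.2) (a + s • v, b + s * k) (v, k)) s :=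
  HasFDerivAt.comp_hasDerivAt (l := fun p : E × ℝ => t p.1 p.2)
    (f := fun s : ℝ => (a + s • v, b + s * k)) s (aux_T1 ht _) (aux_line a v b k s)

lemma aux_g2 {t : E → ℝ → ℝ} (ht : ContDiff ℝ 2 fun p : E × ℝ => t p.1 p.2)
    (a v : E) (b k s : ℝ) :
    HasDerivAt (fun s : ℝ => fderiv ℝ (fun p : E × ℝ => t p.1 p.2) (a + s • v, b + s * k) (v, k))
      (fderiv ℝ (fderiv ℝ (fun p : E × ℝ => t p.1 p.2)) (a + s • v, b + s * k) (v, k) (v, k)) s := by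
  have h := HasFDerivAt.comp_hasDerivAt (l := fderiv ℝ (fun p : E × ℝ => t p.1 p.2))
    (f := fun s : ℝ => (a + s • v, b + s * k)) s (aux_T2 ht _) (aux_line a v b k s)
  have h2 := h.clm_apply (hasDerivAt_const s ((v, k) : E × ℝ))
  simpa using h2

lemma aux_b1 {t : E → ℝ → ℝ} (ht : ContDiff ℝ 2 fun p : E × ℝ => t p.1 p.2) (a : E) (b : ℝ) :
    HasDerivAt (t a) (fderiv ℝ (fun p : E × ℝ => t p.1 p.2) (a, b) (0, 1)) b := by
  have := aux_g1 ht a 0 0 1 b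
  simpa using this

lemma aux_b2 {t : E → ℝ → ℝ} (ht : ContDiff ℝ 2 fun p : E × ℝ => t p.1 p.2) (a : E) (b : ℝ) :
    HasDerivAt (deriv (t a))
      (fderiv ℝ (fderiv ℝ (fun p : E × ℝ => t p.1 p.2)) (a, b) (0, 1) (0, 1)) b := by
  have := aux_g2 ht a 0 0 1 b
  have e : deriv (t a) = fun b => fderiv ℝ (fun p : E × ℝ => t p.1 p.2) (a, b) (0, 1) :=
    funext fun b => (aux_b1 ht a b).deriv
  rw [e]
  simpa using this

lemma aux_a1 {t : E → ℝ → ℝ} (ht : ContDiff ℝ 2 fun p : E × ℝ => t p.1 p.2) (a : E) (b : ℝ) :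
    HasFDerivAt (fun x => t x b)
      ((fderiv ℝ (fun p : E × ℝ => t p.1 p.2) (a, b)).comp (ContinuousLinearMap.inl ℝ E ℝ)) a :=
  HasFDerivAt.comp (g := fun p : E × ℝ => t p.1 p.2) (f := fun x : E => (x, b)) a
    (aux_T1 ht (a, b)) (hasFDerivAt_prodMk_left (𝕜 := ℝ) a b)

lemma aux_a2 {t : E → ℝ → ℝ} (ht : ContDiff ℝ 2 fun p : E × ℝ => t p.1 p.2) (a v : E) (b : ℝ) :
    fderiv ℝ (fun a' => fderiv ℝ (fun x => t x b) a') a v v =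
      fderiv ℝ (fderiv ℝ (fun p : E × ℝ => t p.1 p.2)) (a, b) (v, 0) (v, 0) := by
  have e : (fun a' => fderiv ℝ (fun x => t x b) a') = fun a' =>
      (fderiv ℝ (fun p : E × ℝ => t p.1 p.2) (a', b)).comp (ContinuousLinearMap.inl ℝ E ℝ) :=
    funext fun a' => (aux_a1 ht a' b).fderiv
  have h := HasFDerivAt.comp (g := fderiv ℝ (fun p : E × ℝ => t p.1 p.2))
    (f := fun x : E => (x, b)) a (aux_T2 ht (a, b)) (hasFDerivAt_prodMk_left (𝕜 := ℝ) a b)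
  have h2 := h.clm_comp (hasFDerivAt_const (ContinuousLinearMap.inl ℝ E ℝ) a)
  rw [e]
  have h3 := h2.fderiv
  simp only [Function.comp_def] at h3
  rw [h3]
  simp

lemma aux_ab {t : E → ℝ → ℝ} (ht : ContDiff ℝ 2 fun p : E × ℝ => t p.1 p.2) (a v : E) (b : ℝ) :
    fderiv ℝ (fun a' => deriv (t a') b) a v =
      fderiv ℝ (fderiv ℝ (fun p : E × ℝ => t p.1 p.2)) (a, b) (v, 0) (0, 1) := by
  have e : (fun a' => deriv (t a') b) = fun a' =>
      (fderiv ℝ (fun p : E × ℝ => t p.1 p.2) (a', b)) (0, 1) :=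
    funext fun a' => (aux_b1 ht a' b).deriv
  have h := HasFDerivAt.comp (g := fderiv ℝ (fun p : E × ℝ => t p.1 p.2))
    (f := fun x : E => (x, b)) a (aux_T2 ht (a, b)) (hasFDerivAt_prodMk_left (𝕜 := ℝ) a b)
  have h2 := h.clm_apply (hasFDerivAt_const ((0, 1) : E × ℝ) a)
  rw [e]
  have h3 := h2.fderiv
  simp only [Function.comp_def] at h3
  rw [h3]
  simp

lemma aux_second {g g' : ℝ → ℝ} {L m : ℝ} (hg : ∀ s, HasDerivAt g (g' s) s) (hL : g' 0 = L)
    (hg' : HasDerivAt g' m 0) (hm : m < 0) : ∀ᶠ s in 𝓝[≠] (0 : ℝ), g s < g 0 + s * L := by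
  have h1 : ∀ s, HasDerivAt (fun s => g s - s * L - (m / 4) * s ^ 2)
      (g' s - L - (m / 2) * s) s := by
    intro s
    have := ((hg s).sub ((hasDerivAt_id s).mul_const L)).sub
      (((hasDerivAt_id s).pow 2).const_mul (m / 4))
    refine HasDerivAt.congr_deriv (f := fun s => g s - s * L - (m / 4) * s ^ 2) this ?_
    simp; ring
  have h2 : HasDerivAt (fun s => g' s - L - (m / 2) * s) (m / 2) 0 := by
    have := (hg'.sub_const L).sub ((hasDerivAt_id (0 : ℝ)).const_mul (m / 2))
    refine HasDerivAt.congr_deriv (f := fun s => g' s - L - (m / 2) * s) this ?_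
    ring
  have e : deriv (fun s => g s - s * L - (m / 4) * s ^ 2) = fun s => g' s - L - (m / 2) * s :=
    funext fun s => (h1 s).deriv
  have h3 : IsLocalMax (fun s => g s - s * L - (m / 4) * s ^ 2) 0 := by
    apply isLocalMax_of_deriv_deriv_neg
    · rw [e, h2.deriv]; linarith
    · rw [e]; simp [hL]
    · exact (h1 0).continuousAt
  filter_upwards [h3.filter_mono nhdsWithin_le_nhds, self_mem_nhdsWithin] with s hs hs0
  have : 0 < s ^ 2 := by have : s ≠ 0 := hs0; positivity
  simp at hs
  nlinarith

lemma aux_F_le {t : E → ℝ → ℝ} (ht : ContDiff ℝ 2 fun p : E × ℝ => t p.1 p.2) {η : ℝ} (a : E)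
    {b : ℝ} (hb : b ∈ Icc (-η) η) : sInf (t a '' Icc (-η) η) ≤ t a b := by
  have hc : Continuous (t a) := ht.continuous.comp (Continuous.prodMk_right a)
  exact csInf_le (isCompact_Icc.image hc).bddBelow ⟨b, hb, rfl⟩

lemma aux_F_eq {t : E → ℝ → ℝ} {η : ℝ} (a : E)
    {b : ℝ} (hb : b ∈ Icc (-η) η) (hm : IsMinOn (t a) (Icc (-η) η) b) :
    sInf (t a '' Icc (-η) η) = t a b := by
  refine IsLeast.csInf_eq ⟨⟨b, hb, rfl⟩, ?_⟩
  rintro _ ⟨c, hc, rfl⟩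
  exact hm hc

lemma aux_key {t : E → ℝ → ℝ} (ht : ContDiff ℝ 2 fun p : E × ℝ => t p.1 p.2) {η : ℝ} (a v : E)
    {b : ℝ} (hb : b ∈ Ioo (-η) η) (hm : IsMinOn (t a) (Icc (-η) η) b)
    (hbb : 0 < deriv (deriv (t a)) b) (hb0 : deriv (t a) b = 0)
    (hneg : fderiv ℝ (fun a' => fderiv ℝ (fun x => t x b) a') a v v -
          (deriv (deriv (t a)) b)⁻¹ * (fderiv ℝ (fun a' => deriv (t a') b) a v) ^ 2 < 0) :
    ∀ᶠ s in 𝓝[≠] (0 : ℝ), sInf (t (a + s • v) '' Icc (-η) η) <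
      sInf (t a '' Icc (-η) η) + s * fderiv ℝ (fun p : E × ℝ => t p.1 p.2) (a, b) (v, 0) := by
  rw [aux_a2 ht, aux_ab ht] at hneg
  rw [(aux_b2 ht a b).deriv] at hneg hbb
  rw [(aux_b1 ht a b).deriv] at hb0
  have hsym := (ht.contDiffAt (x := (a, b))).isSymmSndFDerivAt (by simp)
  have hs1 := hsym.eq (v, 0) (0, 1)
  set D := fderiv ℝ (fderiv ℝ (fun p : E × ℝ => t p.1 p.2)) (a, b) with hD
  set k : ℝ := - (D (0, 1) (0, 1))⁻¹ * D (v, 0) (0, 1) with hk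
  have hdec : ((v, k) : E × ℝ) = (v, 0) + k • (0, 1) := by simp
  have h2 : D (v, k) (v, k) < 0 := by
    rw [hdec]
    simp only [map_add, map_smul, ContinuousLinearMap.add_apply, ContinuousLinearMap.smul_apply,
      smul_eq_mul, ← hs1]
    refine lt_of_le_of_lt (le_of_eq ?_) hneg
    rw [hk]
    field_simp
    ring
  have h1 : fderiv ℝ (fun p : E × ℝ => t p.1 p.2) (a, b) (v, k) =
      fderiv ℝ (fun p : E × ℝ => t p.1 p.2) (a, b) (v, 0) := by
    rw [hdec, map_add, map_smul, hb0]; simp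
  have key := aux_second (L := fderiv ℝ (fun p : E × ℝ => t p.1 p.2) (a, b) (v, 0)) (m := D (v, k) (v, k))
    (fun s => aux_g1 ht a v b k s)
    (by simpa using h1) (by simpa [hD] using aux_g2 ht a v b k 0) h2
  have hin : ∀ᶠ s in 𝓝[≠] (0 : ℝ), b + s * k ∈ Ioo (-η) η := by
    apply Filter.Eventually.filter_mono nhdsWithin_le_nhds
    have : ContinuousAt (fun s : ℝ => b + s * k) 0 := by fun_prop
    apply this.eventually_mem
    apply isOpen_Ioo.mem_nhds
    simpa using hb
  filter_upwards [key, hin] with s hs hs2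
  rw [aux_F_eq a (Ioo_subset_Icc_self hb) hm]
  have := aux_F_le ht (a + s • v) (Ioo_subset_Icc_self hs2)
  simp only [zero_smul, add_zero, zero_mul] at hs
  linarith

/-- stationarity at an interior maximiser -/
lemma aux_stat {t : E → ℝ → ℝ} (ht : ContDiff ℝ 2 fun p : E × ℝ => t p.1 p.2) {η : ℝ} (hη : 0 < η)
    (a v : E) {b : ℝ} (hb : b ∈ Icc (-η) η)
    (huniq : ∀ y ∈ Icc (-η) η, IsMinOn (t a) (Icc (-η) η) y → y = b)
    (hmax : IsLocalMax (fun a => sInf (t a '' Icc (-η) η)) a) :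
    fderiv ℝ (fun p : E × ℝ => t p.1 p.2) (a, b) (v, 0) ≤ 0 := by
  by_contra! hpos
  have hT := ht.continuous
  have hF : Continuous (fun a => sInf (t a '' Icc (-η) η)) := isCompact_Icc.continuous_sInf hT
  have hex : ∀ a, ∃ b ∈ Icc (-η) η, IsMinOn (t a) (Icc (-η) η) b := fun a =>
    isCompact_Icc.exists_isMinOn ⟨0, by constructor <;> linarith⟩
      (hT.comp (Continuous.prodMk_right a)).continuousOn
  choose β hβ hβm using hex
  have hlim : Tendsto β (𝓝 a) (𝓝 b) := by
    refine isCompact_Icc.tendsto_nhds_of_unique_mapClusterPt (Eventually.of_forall hβ) ?_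
    intro y hy hcl
    apply huniq y hy
    by_contra hn
    have hlt : sInf (t a '' Icc (-η) η) < t a y := by
      refine lt_of_le_of_ne (aux_F_le ht a hy) fun he => hn fun c hc => ?_
      have := aux_F_le ht a hc
      simp only [mem_setOf_eq]; linarith
    have hev : ∀ᶠ p in 𝓝 (a, y), sInf (t p.1 '' Icc (-η) η) < t p.1 p.2 :=
      (hF.comp continuous_fst).continuousAt.eventually_lt hT.continuousAt hlt
    rw [nhds_prod_eq] at hev
    obtain ⟨P, hP, Q, hQ, hPQ⟩ := Filter.eventually_prod_iff.1 hev
    obtain ⟨x, hx1, hx2⟩ := ((mapClusterPt_iff_frequently.1 hcl _ hQ).and_eventually hP).exists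
    have := hPQ hx2 hx1
    rw [aux_F_eq x (hβ x) (hβm x)] at this
    exact lt_irrefl _ this
  have hline : Tendsto (fun s : ℝ => a + s • v) (𝓝 0) (𝓝 a) := by
    have : Continuous (fun s : ℝ => a + s • v) := by fun_prop
    simpa using this.tendsto 0
  have hDc : Continuous (fun p : ℝ × ℝ =>
      fderiv ℝ (fun p : E × ℝ => t p.1 p.2) (a + p.1 • v, p.2) (v, 0)) := by
    have := ht.continuous_fderiv (by norm_num)
    fun_prop
  have hev : ∀ᶠ p in 𝓝 ((0, b) : ℝ × ℝ),
      0 < fderiv ℝ (fun p : E × ℝ => t p.1 p.2) (a + p.1 • v, p.2) (v, 0) :=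
    continuousAt_const.eventually_lt hDc.continuousAt (by simpa using hpos)
  rw [nhds_prod_eq] at hev
  obtain ⟨P, hP, Q, hQ, hPQ⟩ := Filter.eventually_prod_iff.1 hev
  have hQ' := (hlim.comp hline).eventually hQ
  have hM := hline.eventually hmax
  obtain ⟨ε, hε, hball⟩ := Metric.eventually_nhds_iff.1 (hP.and (hQ'.and hM))
  have hs : ∀ s ∈ Icc (0 : ℝ) (ε / 2), dist s 0 < ε := by
    intro s hs
    rw [Real.dist_eq, sub_zero, abs_of_nonneg hs.1]; linarith [hs.2]
  have he := hball (hs (ε / 2) ⟨by linarith, le_refl _⟩)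
  set y := β (a + (ε / 2) • v) with hy
  have hd : ∀ s, HasDerivAt (fun s : ℝ => t (a + s • v) y)
      (fderiv ℝ (fun p : E × ℝ => t p.1 p.2) (a + s • v, y) (v, 0)) s := by
    intro s
    simpa using aux_g1 ht a v y 0 s
  have hmono : StrictMonoOn (fun s : ℝ => t (a + s • v) y) (Icc 0 (ε / 2)) := by
    refine strictMonoOn_of_deriv_pos (convex_Icc _ _)
      (fun s _ => (hd s).continuousAt.continuousWithinAt) fun s hs' => ?_
    rw [(hd s).deriv]
    exact hPQ (hball (hs s (interior_subset hs'))).1 he.2.1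
  have h1 := hmono ⟨le_refl _, by linarith⟩ ⟨by linarith, le_refl _⟩ (show (0 : ℝ) < ε / 2 by linarith)
  have h2 := he.2.2
  have h3 := aux_F_le ht a (hβ (a + (ε / 2) • v))
  have h4 := aux_F_eq _ (hβ (a + (ε / 2) • v)) (hβm (a + (ε / 2) • v))
  simp only [zero_smul, add_zero] at h1
  simp only [mem_setOf_eq] at h2
  linarith

end aux

/-- Lemma: minimax is achieved at the unique critical point.
`t` is (twice continuously differentiable) on `ℝⁿ × ℝ`, `A(d)` is the closed ball of radius
`d`.  Condition (iii), that the largest eigenvalue of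
`∇²_a t − (∂_b ∇_a t)(∂_b ∇_a t)ᵀ / ∂_{bb} t` is negative, is expressed as negative
definiteness of the corresponding quadratic form.  Condition (iv) expresses the (one-sided)
directional derivative of `a ↦ inf_b t(a,b)` in the direction `a` at boundary points.
A critical point of `t` is a zero of the full gradient `fderiv ℝ (fun (a,b) => t a b)`. -/
theorem stmt_19 (n : ℕ) (hn : 1 ≤ n) (d η : ℝ) (hd : 0 < d) (hη : 0 < η)
    (t : EuclideanSpace ℝ (Fin n) → ℝ → ℝ)
    (ht : ContDiff ℝ 2 fun p : EuclideanSpace ℝ (Fin n) × ℝ => t p.1 p.2)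
    (hbb : ∀ a ∈ Metric.closedBall (0 : EuclideanSpace ℝ (Fin n)) d,
      ∀ b ∈ Set.Icc (-η) η, 0 < deriv (deriv (t a)) b)
    (hbpos : ∀ a ∈ Metric.closedBall (0 : EuclideanSpace ℝ (Fin n)) d, 0 < deriv (t a) η)
    (hbneg : ∀ a ∈ Metric.closedBall (0 : EuclideanSpace ℝ (Fin n)) d, deriv (t a) (-η) < 0)
    (hneg : ∀ a ∈ Metric.closedBall (0 : EuclideanSpace ℝ (Fin n)) d, ∀ b ∈ Set.Icc (-η) η,
      ∀ v : EuclideanSpace ℝ (Fin n), v ≠ 0 →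
        fderiv ℝ (fun a' => fderiv ℝ (fun x => t x b) a') a v v -
          (deriv (deriv (t a)) b)⁻¹ * (fderiv ℝ (fun a' => deriv (t a') b) a v) ^ 2 < 0)
    (hbdry : ∀ a : EuclideanSpace ℝ (Fin n), ‖a‖ = d →
      ∃ c : ℝ, c < 0 ∧ HasDerivWithinAt
        (fun s : ℝ => sInf (t (a + s • a) '' Set.Icc (-η) η)) c (Set.Iic 0) 0) :
    ∃ p : EuclideanSpace ℝ (Fin n) × ℝ,
      p ∈ Metric.closedBall (0 : EuclideanSpace ℝ (Fin n)) d ×ˢ Set.Icc (-η) η ∧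
      fderiv ℝ (fun q : EuclideanSpace ℝ (Fin n) × ℝ => t q.1 q.2) p = 0 ∧
      (∀ q ∈ Metric.closedBall (0 : EuclideanSpace ℝ (Fin n)) d ×ˢ Set.Icc (-η) η,
        fderiv ℝ (fun q : EuclideanSpace ℝ (Fin n) × ℝ => t q.1 q.2) q = 0 → q = p) ∧
      IsMaxOn (fun a => sInf (t a '' Set.Icc (-η) η))
        (Metric.closedBall (0 : EuclideanSpace ℝ (Fin n)) d) p.1 ∧
      (∀ a ∈ Metric.closedBall (0 : EuclideanSpace ℝ (Fin n)) d,
        IsMaxOn (fun a' => sInf (t a' '' Set.Icc (-η) η))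
          (Metric.closedBall (0 : EuclideanSpace ℝ (Fin n)) d) a → a = p.1) ∧
      IsMinOn (t p.1) (Set.Icc (-η) η) p.2 ∧
      (∀ b ∈ Set.Icc (-η) η, IsMinOn (t p.1) (Set.Icc (-η) η) b → b = p.2) := by
  have hT := ht.continuous
  have hF : Continuous (fun a => sInf (t a '' Icc (-η) η)) := isCompact_Icc.continuous_sInf hT
  have hmon : ∀ a ∈ Metric.closedBall (0 : EuclideanSpace ℝ (Fin n)) d,
      StrictMonoOn (deriv (t a)) (Icc (-η) η) := fun a ha =>
    strictMonoOn_of_deriv_pos (convex_Icc _ _)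
      (fun b _ => (aux_b2 ht a b).continuousAt.continuousWithinAt)
      (fun b hb => hbb a ha b (interior_subset hb))
  -- minimisers are interior and stationary
  have hmin : ∀ a ∈ Metric.closedBall (0 : EuclideanSpace ℝ (Fin n)) d, ∀ b ∈ Icc (-η) η,
      IsMinOn (t a) (Icc (-η) η) b → b ∈ Ioo (-η) η ∧ deriv (t a) b = 0 := by
    intro a ha b hb hm
    have hd1 : HasDerivWithinAt (t a) (deriv (t a) b) (Icc (-η) η) b :=
      (aux_b1 ht a b).differentiableAt.hasDerivAt.hasDerivWithinAt
    have hin : b ∈ Ioo (-η) η := by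
      constructor
      · refine lt_of_le_of_ne hb.1 fun he => ?_
        have := aux_min_endpoint (y := η) ((convex_Icc (-η) η).segment_subset hb
          ⟨by linarith, le_refl _⟩) hm hd1
        have h2 := hbneg a ha
        rw [he] at h2
        nlinarith
      · refine lt_of_le_of_ne hb.2 fun he => ?_
        have := aux_min_endpoint (y := -η) ((convex_Icc (-η) η).segment_subset hb
          ⟨le_refl _, by linarith⟩) hm hd1
        have h2 := hbpos a ha
        rw [← he] at h2
        nlinarith
    exact ⟨hin, (hm.isLocalMin (Icc_mem_nhds hin.1 hin.2)).deriv_eq_zero⟩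
  have hex : ∀ a, ∃ b ∈ Icc (-η) η, IsMinOn (t a) (Icc (-η) η) b := fun a =>
    isCompact_Icc.exists_isMinOn ⟨0, by constructor <;> linarith⟩
      (hT.comp (Continuous.prodMk_right a)).continuousOn
  have hcrit : ∀ a ∈ Metric.closedBall (0 : EuclideanSpace ℝ (Fin n)) d, ∀ b ∈ Icc (-η) η,
      deriv (t a) b = 0 → IsMinOn (t a) (Icc (-η) η) b := by
    intro a ha b hb h0
    obtain ⟨c, hc, hm⟩ := hex a
    rw [(hmon a ha).injOn hb hc (h0.trans (hmin a ha c hc hm).2.symm)]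
    exact hm
  have huniq : ∀ a ∈ Metric.closedBall (0 : EuclideanSpace ℝ (Fin n)) d, ∀ b ∈ Icc (-η) η,
      IsMinOn (t a) (Icc (-η) η) b → ∀ c ∈ Icc (-η) η, IsMinOn (t a) (Icc (-η) η) c → c = b := by
    intro a ha b hb hm c hc hm'
    exact (hmon a ha).injOn hc hb ((hmin a ha c hc hm').2.trans (hmin a ha b hb hm).2.symm)
  -- maximisers give critical points
  have hmaxcrit : ∀ a ∈ Metric.closedBall (0 : EuclideanSpace ℝ (Fin n)) d,
      IsMaxOn (fun a => sInf (t a '' Icc (-η) η)) (Metric.closedBall 0 d) a →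
      ∀ b ∈ Icc (-η) η, IsMinOn (t a) (Icc (-η) η) b →
      fderiv ℝ (fun q : EuclideanSpace ℝ (Fin n) × ℝ => t q.1 q.2) (a, b) = 0 := by
    intro a ha hM b hb hm
    have hlt : ‖a‖ < d := by
      refine lt_of_le_of_ne (by simpa using ha) fun he => ?_
      obtain ⟨c, hc, hder⟩ := hbdry a he
      have hsub : Icc (-1 : ℝ) 0 ⊆ Iic 0 := fun x hx => hx.2
      have hm2 : IsMinOn (fun s : ℝ => - sInf (t (a + s • a) '' Icc (-η) η)) (Icc (-1) 0) 0 := by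
        intro s hs
        have hmem : a + s • a ∈ Metric.closedBall (0 : EuclideanSpace ℝ (Fin n)) d := by
          have e : a + s • a = (1 + s) • a := by rw [add_smul, one_smul]
          rw [mem_closedBall_zero_iff, e, norm_smul, Real.norm_eq_abs,
            abs_of_nonneg (by linarith [hs.1]), he]
          nlinarith [hs.2]
        have := hM hmem
        simp only [mem_setOf_eq, zero_smul, add_zero] at this ⊢
        linarith
      have := aux_min_endpoint (y := -1) ((convex_Icc (-1 : ℝ) 0).segment_subset
        ⟨by norm_num, le_refl _⟩ ⟨le_refl _, by norm_num⟩) hm2 (hder.mono hsub).neg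
      linarith
    have hloc : IsLocalMax (fun a => sInf (t a '' Icc (-η) η)) a :=
      hM.isLocalMax (mem_of_superset (Metric.isOpen_ball.mem_nhds (by simpa using hlt))
        Metric.ball_subset_closedBall)
    have hst := fun v => aux_stat ht hη a v hb (huniq a ha b hb hm) hloc
    have hb0 := (hmin a ha b hb hm).2
    rw [(aux_b1 ht a b).deriv] at hb0
    ext v
    · have h1 := hst v
      have h2 := hst (-v)
      have e : ((-v, 0) : EuclideanSpace ℝ (Fin n) × ℝ) = - (v, 0) := by simp
      rw [e, map_neg] at h2
      simpa using le_antisymm h1 (by linarith)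
    · simpa using hb0
  -- critical points coincide with maximisers
  have hcritmax : ∀ a₀ ∈ Metric.closedBall (0 : EuclideanSpace ℝ (Fin n)) d,
      IsMaxOn (fun a => sInf (t a '' Icc (-η) η)) (Metric.closedBall 0 d) a₀ →
      ∀ a ∈ Metric.closedBall (0 : EuclideanSpace ℝ (Fin n)) d, ∀ b ∈ Icc (-η) η,
      fderiv ℝ (fun q : EuclideanSpace ℝ (Fin n) × ℝ => t q.1 q.2) (a, b) = 0 → a = a₀ := by
    intro a₀ ha₀ hM a ha b hb h0
    by_contra hne
    have hv : a₀ - a ≠ 0 := sub_ne_zero.2 (Ne.symm hne)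
    have hb0 : deriv (t a) b = 0 := by rw [(aux_b1 ht a b).deriv, h0]; rfl
    have hbm := hcrit a ha b hb hb0
    have hseg : ∀ s ∈ Icc (0 : ℝ) 1, a + s • (a₀ - a) ∈
        Metric.closedBall (0 : EuclideanSpace ℝ (Fin n)) d := fun s hs =>
      (convex_closedBall _ _).add_smul_sub_mem ha ha₀ hs
    have hφ : Continuous (fun s : ℝ => sInf (t (a + s • (a₀ - a)) '' Icc (-η) η)) :=
      hF.comp (by fun_prop)
    have k1 := aux_key ht a (a₀ - a) (hmin a ha b hb hbm).1 hbm (hbb a ha b hb) hb0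
      (hneg a ha b hb _ hv)
    rw [h0] at k1
    obtain ⟨ε, hε, hε'⟩ := Metric.eventually_nhds_iff.1 (eventually_nhdsWithin_iff.1 k1)
    obtain ⟨s, hs, hsm⟩ := isCompact_Icc.exists_isMinOn (⟨0, by simp⟩ : (Icc (0 : ℝ) 1).Nonempty)
      hφ.continuousOn
    -- a point with smaller value
    have hr : ∃ r ∈ Icc (0 : ℝ) 1, sInf (t (a + r • (a₀ - a)) '' Icc (-η) η) <
        sInf (t a '' Icc (-η) η) := by
      have hpos : 0 < min (ε / 2) 1 := by positivity
      refine ⟨min (ε / 2) 1, ⟨hpos.le, min_le_right _ _⟩, ?_⟩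
      have := hε' (y := min (ε / 2) 1) (by
        rw [Real.dist_eq, sub_zero, abs_of_pos hpos]
        linarith [min_le_left (ε / 2) 1]) hpos.ne'
      simpa using this
    obtain ⟨r, hr, hrlt⟩ := hr
    have hsr := hsm hr
    have h01 : sInf (t a '' Icc (-η) η) ≤ sInf (t a₀ '' Icc (-η) η) := hM ha
    simp only [mem_setOf_eq] at hsr
    have hs0 : 0 < s := by
      refine lt_of_le_of_ne hs.1 fun he => ?_
      rw [← he] at hsr
      simp only [zero_smul, add_zero] at hsr
      linarith
    have hs1 : s < 1 := by
      refine lt_of_le_of_ne hs.2 fun he => ?_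
      rw [he] at hsr
      simp only [one_smul, add_sub_cancel] at hsr
      linarith
    set x := a + s • (a₀ - a) with hx
    have hxm := hseg s hs
    rw [← hx] at hxm
    obtain ⟨c, hc, hcm⟩ := hex x
    have k2 := aux_key ht x (a₀ - a) (hmin x hxm c hc hcm).1 hcm (hbb x hxm c hc)
      (hmin x hxm c hc hcm).2 (hneg x hxm c hc _ hv)
    obtain ⟨δ, hδ, hδ'⟩ := Metric.eventually_nhds_iff.1 (eventually_nhdsWithin_iff.1 k2)
    set ρ := min (δ / 2) (min s (1 - s)) with hρ
    have hρ0 : 0 < ρ := by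
      have : 0 < 1 - s := by linarith
      positivity
    have hρ1 : ρ ≤ δ / 2 := min_le_left _ _
    have hρ2 : ρ ≤ s := (min_le_right _ _).trans (min_le_left _ _)
    have hρ3 : ρ ≤ 1 - s := (min_le_right _ _).trans (min_le_right _ _)
    have p1 := hδ' (y := ρ) (by rw [Real.dist_eq, sub_zero, abs_of_pos hρ0]; linarith) hρ0.ne'
    have p2 := hδ' (y := -ρ) (by rw [Real.dist_eq, sub_zero, abs_neg, abs_of_pos hρ0]; linarith)
      (neg_ne_zero.2 hρ0.ne')
    have q1 := hsm (show s + ρ ∈ Icc (0 : ℝ) 1 from ⟨by linarith, by linarith⟩)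
    have q2 := hsm (show s + -ρ ∈ Icc (0 : ℝ) 1 from ⟨by linarith, by linarith⟩)
    simp only [mem_setOf_eq, add_smul, ← add_assoc, ← hx] at q1 q2
    linarith
  obtain ⟨a₀, ha₀, hM⟩ := (isCompact_closedBall (0 : EuclideanSpace ℝ (Fin n)) d).exists_isMaxOn
    ⟨0, by simp [hd.le]⟩ hF.continuousOn
  obtain ⟨b₀, hb₀, hm₀⟩ := hex a₀
  refine ⟨(a₀, b₀), ⟨ha₀, hb₀⟩, hmaxcrit a₀ ha₀ hM b₀ hb₀ hm₀, ?_, hM, ?_, hm₀,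
    huniq a₀ ha₀ b₀ hb₀ hm₀⟩
  · rintro ⟨a, b⟩ ⟨ha, hb⟩ h0
    have e := hcritmax a₀ ha₀ hM a ha b hb h0
    subst e
    have hb0 : deriv (t a) b = 0 := by rw [(aux_b1 ht a b).deriv, h0]; rfl
    rw [huniq a ha₀ b₀ hb₀ hm₀ b hb (hcrit a ha b hb hb0)]
  · intro a ha hMa
    obtain ⟨b, hb, hm⟩ := hex a
    exact hcritmax a₀ ha₀ hM a ha b hb (hmaxcrit a ha hMa b hb hm)
end
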